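/- Let C ⊆ ℝ^m be a closed convex cone with C ≠ {0}, D ⊆ ℝ^n a closed convex cone, G ∈ ℝ^{n×m} a standard Gaussian matrix, and g ∈ ℝ^m, g' ∈ ℝ^n independent standard Gaussian vectors. Then for every monotonically increasing convex function f : ℝ → ℝ such that f(‖Proj_D(g')‖ + ‖Proj_C(g)‖) and f(‖G‖_{C→D}) are integrable, E[ f(‖G‖_{C→D}) ] ≤ E[ f(‖Proj_D(g')‖ + ‖Proj_C(g)‖) ]. -/

import Mathlib

open MeasureTheory ProbabilityTheory Metric Set
open scoped InnerProductSpace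
open scoped Classical
open scoped Pointwise

noncomputable section

/-- Euclidean space `ℝ^k`. -/
abbrev Euc (k : ℕ) : Type := EuclideanSpace ℝ (Fin k)

/-- The linear action of a matrix `A ∈ ℝ^{n×m}` on Euclidean space, `x ↦ Ax`. -/
def mulE {m n : ℕ} (A : Matrix (Fin n) (Fin m) ℝ) (x : Euc m) : Euc n :=
  Matrix.toEuclideanLin A x

/-- The metric projection onto a set `S`: the point of `S` closest to `y`
(if a unique closest point characterizing property holds; junk value `0` otherwise). -/
def metricProj {k : ℕ} (S : Set (Euc k)) (y : Euc k) : Euc k :=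
  if h : ∃ z, z ∈ S ∧ ∀ w ∈ S, dist y z ≤ dist y w then h.choose else 0

/-- `C` is a closed convex cone (containing the origin). -/
def IsClosedConvexCone {k : ℕ} (C : Set (Euc k)) : Prop :=
  IsClosed C ∧ Convex ℝ C ∧ (∀ c : ℝ, 0 ≤ c → ∀ x ∈ C, c • x ∈ C) ∧ (0 : Euc k) ∈ C

/-- The polar cone `S° = {z | ⟨x,z⟩ ≤ 0 ∀ x ∈ S}`. -/
def polarCone {k : ℕ} (S : Set (Euc k)) : Set (Euc k) :=
  {z | ∀ x ∈ S, ⟪x, z⟫_ℝ ≤ 0}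

/-- The restricted norm `‖A‖_{C→D} = max_{x ∈ C ∩ S^{m-1}} ‖Proj_D (Ax)‖`. -/
def resNorm {m n : ℕ} (C : Set (Euc m)) (D : Set (Euc n)) (A : Matrix (Fin n) (Fin m) ℝ) : ℝ :=
  sSup ((fun x => ‖metricProj D (mulE A x)‖) '' (C ∩ sphere 0 1))

/-- The restricted singular value `σ_{C→D}(A) = min_{x ∈ C ∩ S^{m-1}} ‖Proj_D (Ax)‖`. -/
def resSval {m n : ℕ} (C : Set (Euc m)) (D : Set (Euc n)) (A : Matrix (Fin n) (Fin m) ℝ) : ℝ :=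
  sInf ((fun x => ‖metricProj D (mulE A x)‖) '' (C ∩ sphere 0 1))

/-- The restricted norm for arbitrary (not necessarily closed) cones:
`‖B‖_{K→K'} = sup { ⟨Bx, y⟩ : x ∈ K ∩ B^ℓ, y ∈ K' ∩ B^p }`. -/
def resNormGen {l p : ℕ} (K : Set (Euc l)) (K' : Set (Euc p))
    (B : Matrix (Fin p) (Fin l) ℝ) : ℝ :=
  sSup (Set.image2 (fun x y => ⟪mulE B x, y⟫_ℝ) (K ∩ closedBall 0 1) (K' ∩ closedBall 0 1))

/-- The operator (spectral) norm of a matrix. -/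
def opNorm {m n : ℕ} (A : Matrix (Fin n) (Fin m) ℝ) : ℝ :=
  ‖LinearMap.toContinuousLinearMap (Matrix.toEuclideanLin A)‖

/-- The standard Gaussian measure on `ℝ^k` (i.i.d. N(0,1) coordinates). -/
def stdGaussianE (k : ℕ) : Measure (Euc k) :=
  Measure.map (⇑(EuclideanSpace.equiv (Fin k) ℝ).symm)
    (Measure.pi fun _ : Fin k => gaussianReal 0 1)

/-- The standard Gaussian measure on `n × m` arrays (i.i.d. N(0,1) entries). -/
def stdGaussianPi (n m : ℕ) : Measure (Fin n → Fin m → ℝ) :=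
  Measure.pi fun _ : Fin n => Measure.pi fun _ : Fin m => gaussianReal 0 1

/-- The support function `h_K(x) = sup_{z ∈ K} ⟨x, z⟩`. -/
def suppFn {k : ℕ} (K : Set (Euc k)) (x : Euc k) : ℝ := sSup ((fun z => ⟪x, z⟫_ℝ) '' K)

/-- The capped-angle cosine `cos d̄(X,Y) = max{⟨x,y⟩ : x ∈ X ∩ B, y ∈ Y ∩ B}`. -/
def cosAng {k : ℕ} (X Y : Set (Euc k)) : ℝ :=
  sSup (Set.image2 (fun x y => ⟪x, y⟫_ℝ) (X ∩ closedBall 0 1) (Y ∩ closedBall 0 1))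

/-- `sin d̄(X,Y) = √(1 - cos d̄(X,Y)²)`. -/
def sinAng {k : ℕ} (X Y : Set (Euc k)) : ℝ := Real.sqrt (1 - cosAng X Y ^ 2)

/-- The Kronecker (tensor) product `x ⊗ y ∈ ℝ^{mn}`. -/
def kron {m n : ℕ} (x : Euc m) (y : Euc n) : EuclideanSpace ℝ (Fin m × Fin n) :=
  (EuclideanSpace.equiv (Fin m × Fin n) ℝ).symm (fun p => x p.1 * y p.2)

/-- The primal feasible set `𝒫(C,D) = {A | ∃ x ∈ C \ {0}, Ax ∈ D°}`. -/
def primalSet {m n : ℕ} (C : Set (Euc m)) (D : Set (Euc n)) :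
    Set (Matrix (Fin n) (Fin m) ℝ) :=
  {A | ∃ x ∈ C, x ≠ 0 ∧ mulE A x ∈ polarCone D}

/-- The dual feasible set `𝒟(C,D) = {A | ∃ y ∈ D \ {0}, -Aᵀy ∈ C°}`. -/
def dualSet {m n : ℕ} (C : Set (Euc m)) (D : Set (Euc n)) :
    Set (Matrix (Fin n) (Fin m) ℝ) :=
  {A | ∃ y ∈ D, y ≠ 0 ∧ -(mulE A.transpose y) ∈ polarCone C}

/-- `K₂` is a `0`-contraction of `K₁`: there are generating sets `M₁` of `K₁`, `M₂` of `K₂`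
(i.e. `Kᵢ` is the closed convex hull of `Mᵢ`) and a surjection `φ : M₁ → M₂` that is
`1`-Lipschitz and norm-nonincreasing. -/
def IsZeroContractionOf {E₁ E₂ : Type*} [NormedAddCommGroup E₁] [NormedSpace ℝ E₁]
    [NormedAddCommGroup E₂] [NormedSpace ℝ E₂] (K₁ : Set E₁) (K₂ : Set E₂) : Prop :=
  ∃ (M₁ : Set E₁) (M₂ : Set E₂) (φ : E₁ → E₂),
    closure (convexHull ℝ M₁) = K₁ ∧ closure (convexHull ℝ M₂) = K₂ ∧
    φ '' M₁ = M₂ ∧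
    (∀ x ∈ M₁, ∀ x' ∈ M₁, ‖φ x - φ x'‖ ≤ ‖x - x'‖) ∧
    (∀ x ∈ M₁, ‖φ x‖ ≤ ‖x‖)

/-- The pair `(x, y)` regarded as an element of the Euclidean (ℓ²) product. -/
def pairL2 {m n : ℕ} (x : Euc m) (y : Euc n) : WithLp 2 (Euc m × Euc n) :=
  (WithLp.equiv 2 (Euc m × Euc n)).symm (x, y)

/-- The product `K × K'` as a subset of the Euclidean (ℓ²) product space. -/
def prodL2 {m n : ℕ} (K : Set (Euc m)) (K' : Set (Euc n)) : Set (WithLp 2 (Euc m × Euc n)) :=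
  {q | ((WithLp.equiv 2 (Euc m × Euc n)) q).1 ∈ K ∧ ((WithLp.equiv 2 (Euc m × Euc n)) q).2 ∈ K'}

/-- Second-order Taylor expansion on `[0, 1]` with a bound on the remainder. -/
lemma abs_taylor_two_le {g g₁ g₂ g₃ : ℝ → ℝ} {B : ℝ} (h₁ : ∀ t, HasDerivAt g (g₁ t) t)
    (h₂ : ∀ t, HasDerivAt g₁ (g₂ t) t) (h₃ : ∀ t, HasDerivAt g₂ (g₃ t) t)
    (hB : ∀ t, |g₃ t| ≤ B) : |g 1 - g 0 - g₁ 0 - g₂ 0 / 2| ≤ B := by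
  have hB0 : 0 ≤ B := (abs_nonneg _).trans (hB 0)
  have e₂ : ∀ t ∈ Icc (0 : ℝ) 1, |g₂ t - g₂ 0| ≤ B := fun t ht ↦ by
    have := norm_image_sub_le_of_norm_deriv_le_segment' (a := 0) (b := 1)
      (fun x _ ↦ (h₃ x).hasDerivWithinAt) (fun x _ ↦ hB x) t ht
    rw [Real.norm_eq_abs] at this
    exact this.trans (by nlinarith [ht.2])
  have e₁ : ∀ t ∈ Icc (0 : ℝ) 1, |g₁ t - g₂ 0 * t - g₁ 0| ≤ B := fun t ht ↦ by
    have := norm_image_sub_le_of_norm_deriv_le_segment' (f := fun t ↦ g₁ t - g₂ 0 * t)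
      (f' := fun t ↦ g₂ t - g₂ 0) (C := B) (a := 0) (b := 1)
      (fun x _ ↦ by
        exact (((h₂ x).sub ((hasDerivAt_id x).const_mul (g₂ 0))).congr_deriv
          (by simp)).hasDerivWithinAt)
      (fun x hx ↦ e₂ x ⟨hx.1, hx.2.le⟩) t ht
    simp only [Real.norm_eq_abs, mul_zero, sub_zero] at this
    exact this.trans (by nlinarith [ht.2])
  have e₀ := norm_image_sub_le_of_norm_deriv_le_segment_01'
    (f := fun t ↦ g t - g₂ 0 / 2 * t ^ 2 - g₁ 0 * t)
    (f' := fun t ↦ g₁ t - g₂ 0 * t - g₁ 0) (C := B)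
    (fun x _ ↦ by
      have := ((h₁ x).sub ((hasDerivAt_pow 2 x).const_mul (g₂ 0 / 2))).sub
        ((hasDerivAt_id x).const_mul (g₁ 0))
      refine (this.congr_deriv ?_).hasDerivWithinAt
      simp
      ring)
    (fun x hx ↦ e₁ x ⟨hx.1, hx.2.le⟩)
  rw [Real.norm_eq_abs] at e₀
  convert e₀ using 2
  ring

/-- A nonnegative nondecreasing function with three bounded derivatives. -/
structure IsSmoothStep (θ θ₁ θ₂ θ₃ : ℝ → ℝ) (M : ℝ) : Prop where
  deriv_one : ∀ t, HasDerivAt θ (θ₁ t) t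
  deriv_two : ∀ t, HasDerivAt θ₁ (θ₂ t) t
  deriv_three : ∀ t, HasDerivAt θ₂ (θ₃ t) t
  nonneg : ∀ t, 0 ≤ θ t
  deriv_nonneg : ∀ t, 0 ≤ θ₁ t
  bound_one : ∀ t, |θ₁ t| ≤ M
  bound_two : ∀ t, |θ₂ t| ≤ M
  bound_three : ∀ t, |θ₃ t| ≤ M

/-- The smooth transition function, rescaled and translated, has bounded derivatives. -/
lemma exists_isSmoothStep (K u : ℝ) (hK : 0 ≤ K) :
    ∃ θ₁ θ₂ θ₃ M, IsSmoothStep (fun x ↦ K * Real.smoothTransition (x - u)) θ₁ θ₂ θ₃ M := by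
  set θ : ℝ → ℝ := fun x ↦ K * Real.smoothTransition (x - u) with hθ
  have hs : ContDiff ℝ 4 θ :=
    contDiff_const.mul ((Real.smoothTransition.contDiff (n := 4)).comp
      (contDiff_id.sub contDiff_const))
  have hs₁ : ContDiff ℝ 3 (deriv θ) := by
    have : ContDiff ℝ (3 + 1) θ := by norm_num; exact hs
    exact (contDiff_succ_iff_deriv.1 this).2.2
  have hs₂ : ContDiff ℝ 2 (deriv (deriv θ)) := by
    have : ContDiff ℝ (2 + 1) (deriv θ) := by norm_num; exact hs₁
    exact (contDiff_succ_iff_deriv.1 this).2.2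
  have hs₃ : ContDiff ℝ 1 (deriv (deriv (deriv θ))) := by
    have : ContDiff ℝ (1 + 1) (deriv (deriv θ)) := by norm_num; exact hs₂
    exact (contDiff_succ_iff_deriv.1 this).2.2
  have hmono : Monotone θ := fun x y hxy ↦
    mul_le_mul_of_nonneg_left (Real.smoothTransition.monotone (by linarith)) hK
  have hc₁ : HasCompactSupport (deriv θ) := by
    refine HasCompactSupport.intro (K := Icc u (u + 1)) isCompact_Icc fun x hx ↦ ?_
    rw [mem_Icc, not_and_or, not_le, not_le] at hx
    rcases hx with hx | hx
    · have : θ =ᶠ[nhds x] fun _ ↦ 0 := by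
        filter_upwards [Iio_mem_nhds hx] with y hy
        simp [hθ, Real.smoothTransition.zero_of_nonpos (sub_nonpos.2 (le_of_lt hy))]
      simp [this.deriv_eq]
    · have : θ =ᶠ[nhds x] fun _ ↦ K := by
        filter_upwards [Ioi_mem_nhds hx] with y hy
        rw [mem_Ioi] at hy
        simp [hθ, Real.smoothTransition.one_of_one_le (show 1 ≤ y - u by linarith)]
      simp [this.deriv_eq]
  obtain ⟨M₁, hM₁⟩ := hs₁.continuous.bounded_above_of_compact_support hc₁
  obtain ⟨M₂, hM₂⟩ := hs₂.continuous.bounded_above_of_compact_support hc₁.deriv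
  obtain ⟨M₃, hM₃⟩ := hs₃.continuous.bounded_above_of_compact_support hc₁.deriv.deriv
  refine ⟨deriv θ, deriv (deriv θ), deriv (deriv (deriv θ)), max M₁ (max M₂ M₃), ?_⟩
  exact
    { deriv_one := fun t ↦ (hs.differentiable (by norm_num) t).hasDerivAt
      deriv_two := fun t ↦ (hs₁.differentiable (by norm_num) t).hasDerivAt
      deriv_three := fun t ↦ (hs₂.differentiable (by norm_num) t).hasDerivAt
      nonneg := fun t ↦ mul_nonneg hK (Real.smoothTransition.nonneg _)
      deriv_nonneg := fun t ↦ hmono.deriv_nonneg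
      bound_one := fun t ↦ (hM₁ t).trans (le_max_left _ _)
      bound_two := fun t ↦ (hM₂ t).trans ((le_max_left _ _).trans (le_max_right _ _))
      bound_three := fun t ↦ (hM₃ t).trans ((le_max_right _ _).trans (le_max_right _ _)) }

section Slepian

variable {ι : Type*} [Fintype ι]

/-- The function `x ↦ exp (-∑ i, θ (x i))`, a smooth surrogate for an orthant indicator. -/
def expNegSum (θ : ℝ → ℝ) (x : ι → ℝ) : ℝ := Real.exp (-∑ i, θ (x i))

/-- The second derivatives of `expNegSum θ`. -/
def expNegSumHess (θ θ₁ θ₂ : ℝ → ℝ) (s : ι → ℝ) (i j : ι) : ℝ :=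
  (θ₁ (s i) * θ₁ (s j) - if i = j then θ₂ (s i) else 0) * expNegSum θ s

variable {θ θ₁ θ₂ θ₃ : ℝ → ℝ} {M : ℝ}

lemma IsSmoothStep.continuous (h : IsSmoothStep θ θ₁ θ₂ θ₃ M) : Continuous θ :=
  continuous_iff_continuousAt.2 fun t ↦ (h.deriv_one t).continuousAt

lemma IsSmoothStep.continuous_expNegSum (h : IsSmoothStep θ θ₁ θ₂ θ₃ M) :
    Continuous (expNegSum θ : (ι → ℝ) → ℝ) := by
  have := h.continuous
  unfold expNegSum
  fun_prop

lemma expNegSum_nonneg (x : ι → ℝ) : 0 ≤ expNegSum θ x := (Real.exp_pos _).le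

lemma expNegSum_le_one (hθ : ∀ t, 0 ≤ θ t) (x : ι → ℝ) : expNegSum θ x ≤ 1 :=
  Real.exp_le_one_iff.2 (neg_nonpos.2 (Finset.sum_nonneg fun _ _ ↦ hθ _))

/-- Uniform second-order Taylor expansion of `expNegSum θ`. -/
lemma IsSmoothStep.exists_taylor_expNegSum (h : IsSmoothStep θ θ₁ θ₂ θ₃ M) :
    ∃ B, 0 ≤ B ∧ ∀ s v : ι → ℝ,
      |expNegSum θ (s + v) - expNegSum θ s - (∑ i, -(θ₁ (s i) * expNegSum θ s) * v i)
        - (∑ i, ∑ j, expNegSumHess θ θ₁ θ₂ s i j * (v i * v j)) / 2| ≤ B * ‖v‖ ^ 3 := by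
  have hM : 0 ≤ M := (abs_nonneg _).trans (h.bound_one 0)
  set c : ℝ := Fintype.card ι * M with hc
  have hc0 : 0 ≤ c := by positivity
  refine ⟨c ^ 3 + 3 * c * c + c, by positivity, fun s v ↦ ?_⟩
  let T : ℝ → ℝ := fun t ↦ ∑ i, θ (s i + t * v i)
  let T₁ : ℝ → ℝ := fun t ↦ ∑ i, θ₁ (s i + t * v i) * v i
  let T₂ : ℝ → ℝ := fun t ↦ ∑ i, θ₂ (s i + t * v i) * v i ^ 2
  let T₃ : ℝ → ℝ := fun t ↦ ∑ i, θ₃ (s i + t * v i) * v i ^ 3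
  have hlin (i : ι) (t : ℝ) : HasDerivAt (fun t ↦ s i + t * v i) (v i) t := by
    simpa using ((hasDerivAt_id t).mul_const (v i)).const_add (s i)
  have hT (t : ℝ) : HasDerivAt T (T₁ t) t :=
    HasDerivAt.fun_sum fun i _ ↦ (h.deriv_one _).comp t (hlin i t)
  have hT₁ (t : ℝ) : HasDerivAt T₁ (T₂ t) t :=
    HasDerivAt.fun_sum fun i _ ↦
      (((h.deriv_two _).comp t (hlin i t)).mul_const (v i)).congr_deriv (by ring)
  have hT₂ (t : ℝ) : HasDerivAt T₂ (T₃ t) t :=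
    HasDerivAt.fun_sum fun i _ ↦
      (((h.deriv_three _).comp t (hlin i t)).mul_const (v i ^ 2)).congr_deriv (by ring)
  have hsum (φ : ℝ → ℝ) (hφ : ∀ t, |φ t| ≤ M) (k : ℕ) (t : ℝ) :
      |∑ i, φ (s i + t * v i) * v i ^ k| ≤ c * ‖v‖ ^ k := by
    refine (Finset.abs_sum_le_sum_abs _ _).trans ?_
    calc ∑ i, |φ (s i + t * v i) * v i ^ k| ≤ ∑ _i : ι, M * ‖v‖ ^ k := by
          refine Finset.sum_le_sum fun i _ ↦ ?_
          rw [abs_mul, abs_pow]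
          have := norm_le_pi_norm v i
          rw [Real.norm_eq_abs] at this
          gcongr
          exact hφ _
      _ = c * ‖v‖ ^ k := by simp [hc, mul_assoc]
  have hb₁ (t : ℝ) : |T₁ t| ≤ c * ‖v‖ := by simpa [T₁] using hsum θ₁ h.bound_one 1 t
  have hb₂ (t : ℝ) : |T₂ t| ≤ c * ‖v‖ ^ 2 := hsum θ₂ h.bound_two 2 t
  have hb₃ (t : ℝ) : |T₃ t| ≤ c * ‖v‖ ^ 3 := hsum θ₃ h.bound_three 3 t
  have hE (t : ℝ) : HasDerivAt (fun t ↦ Real.exp (-T t)) (Real.exp (-T t) * -T₁ t) t :=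
    (hT t).neg.exp
  have key := abs_taylor_two_le (g := fun t ↦ Real.exp (-T t))
    (g₁ := fun t ↦ Real.exp (-T t) * -T₁ t)
    (g₂ := fun t ↦ Real.exp (-T t) * (T₁ t ^ 2 - T₂ t))
    (g₃ := fun t ↦ Real.exp (-T t) * (-T₁ t ^ 3 + 3 * (T₁ t * T₂ t) - T₃ t))
    (B := (c ^ 3 + 3 * c * c + c) * ‖v‖ ^ 3) hE
    (fun t ↦ ((hE t).mul (hT₁ t).neg).congr_deriv (by simp; ring))
    (fun t ↦ ((hE t).mul (((hT₁ t).pow 2).sub (hT₂ t))).congr_deriv (by simp; ring))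
    (fun t ↦ by
      rw [abs_mul, abs_of_pos (Real.exp_pos _)]
      have hle : Real.exp (-T t) ≤ 1 :=
        Real.exp_le_one_iff.2 (neg_nonpos.2 (Finset.sum_nonneg fun _ _ ↦ h.nonneg _))
      have h1 : |T₁ t| ^ 3 ≤ (c * ‖v‖) ^ 3 := by gcongr; exact hb₁ t
      have h2 : |T₁ t| * |T₂ t| ≤ (c * ‖v‖) * (c * ‖v‖ ^ 2) :=
        mul_le_mul (hb₁ t) (hb₂ t) (abs_nonneg _) (by positivity)
      have h3 : |-T₁ t ^ 3 + 3 * (T₁ t * T₂ t) - T₃ t| ≤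
          |T₁ t| ^ 3 + 3 * (|T₁ t| * |T₂ t|) + |T₃ t| := by
        refine (abs_sub _ _).trans (add_le_add_left ((abs_add_le _ _).trans ?_) _)
        rw [abs_neg, abs_pow, abs_mul, abs_mul, abs_of_pos (show (0 : ℝ) < 3 by norm_num)]
      calc _ ≤ 1 * |-T₁ t ^ 3 + 3 * (T₁ t * T₂ t) - T₃ t| := by gcongr
        _ ≤ (c * ‖v‖) ^ 3 + 3 * ((c * ‖v‖) * (c * ‖v‖ ^ 2)) + c * ‖v‖ ^ 3 := by
          linarith [hb₃ t]
        _ = _ := by ring)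
  have e1 : Real.exp (-T 1) = expNegSum θ (s + v) := by simp [T, expNegSum]
  have e0 : Real.exp (-T 0) = expNegSum θ s := by simp [T, expNegSum]
  simp only [e1, e0] at key
  convert key using 4
  · simp only [T₁, zero_mul, add_zero, mul_neg, Finset.mul_sum, ← Finset.sum_neg_distrib]
    exact Finset.sum_congr rfl fun i _ ↦ by ring
  · have hsq : T₁ 0 ^ 2 = ∑ i, ∑ j, θ₁ (s i) * v i * (θ₁ (s j) * v j) := by
      simp only [T₁, zero_mul, add_zero, sq, Finset.sum_mul_sum]
    rw [hsq]
    simp only [T₂, zero_mul, add_zero, expNegSumHess, sub_mul, Finset.sum_sub_distrib, mul_sub,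
      ite_mul, Finset.sum_ite_eq, Finset.mem_univ, if_true, Finset.mul_sum]
    congr 1
    · exact Finset.sum_congr rfl fun i _ ↦ Finset.sum_congr rfl fun j _ ↦ by ring
    · exact Finset.sum_congr rfl fun i _ ↦ by ring

/-- Expectation of `expNegSum θ` under a small centered Gaussian perturbation. -/
lemma IsSmoothStep.exists_integral_taylor (h : IsSmoothStep θ θ₁ θ₂ θ₃ M)
    (μ : Measure (ι → ℝ)) [IsGaussian μ] (hμ : ∀ i, ∫ x, x i ∂μ = 0) :
    ∃ K, 0 ≤ K ∧ ∀ c : ℝ, 0 ≤ c → ∀ s : ι → ℝ,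
      |∫ x, expNegSum θ (s + c • x) ∂μ - expNegSum θ s
        - c ^ 2 / 2 * ∑ i, ∑ j, expNegSumHess θ θ₁ θ₂ s i j * ∫ x, x i * x j ∂μ| ≤ K * c ^ 3 := by
  obtain ⟨B, hB0, hB⟩ := h.exists_taylor_expNegSum (ι := ι)
  have hcont := h.continuous_expNegSum (ι := ι)
  have hLp (i : ι) : MemLp (fun x : ι → ℝ ↦ x i) 2 μ :=
    IsGaussian.memLp_dual μ (ContinuousLinearMap.proj i) 2 (by simp)
  have hi1 (i : ι) : Integrable (fun x : ι → ℝ ↦ x i) μ := (hLp i).integrable (by norm_num)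
  have hi2 (i j : ι) : Integrable (fun x : ι → ℝ ↦ x i * x j) μ := (hLp i).integrable_mul (hLp j)
  have hi3 : Integrable (fun x : ι → ℝ ↦ ‖x‖ ^ 3) μ := by
    simpa using (IsGaussian.memLp_id μ 3 (by simp)).integrable_norm_pow (by norm_num)
  refine ⟨B * ∫ x, ‖x‖ ^ 3 ∂μ, by positivity, fun c hc s ↦ ?_⟩
  have hF : Integrable (fun x ↦ expNegSum θ (s + c • x)) μ := by
    refine Integrable.of_bound (C := 1) (by fun_prop) (Filter.Eventually.of_forall fun x ↦ ?_)
    rw [Real.norm_eq_abs, abs_of_nonneg (expNegSum_nonneg _)]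
    exact expNegSum_le_one h.nonneg _
  have hA' (i : ι) : Integrable (fun x ↦ -(θ₁ (s i) * expNegSum θ s) * (c • x) i) μ :=
    ((hi1 i).const_mul c).const_mul _
  have hA : Integrable (fun x ↦ ∑ i, -(θ₁ (s i) * expNegSum θ s) * (c • x) i) μ :=
    integrable_finsetSum _ fun i _ ↦ hA' i
  have hH' (i j : ι) :
      Integrable (fun x ↦ expNegSumHess θ θ₁ θ₂ s i j * ((c • x) i * (c • x) j)) μ := by
    have : (fun x : ι → ℝ ↦ expNegSumHess θ θ₁ θ₂ s i j * ((c • x) i * (c • x) j)) =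
        fun x ↦ expNegSumHess θ θ₁ θ₂ s i j * c ^ 2 * (x i * x j) := by
      ext x
      simp only [Pi.smul_apply, smul_eq_mul]
      ring
    rw [this]
    exact (hi2 i j).const_mul _
  have hH : Integrable
      (fun x ↦ (∑ i, ∑ j, expNegSumHess θ θ₁ θ₂ s i j * ((c • x) i * (c • x) j)) / 2) μ :=
    (integrable_finsetSum _ fun i _ ↦ integrable_finsetSum _ fun j _ ↦ hH' i j).div_const 2
  have key := norm_integral_le_of_norm_le (μ := μ) ((hi3.const_mul (B * c ^ 3)))
    (Filter.Eventually.of_forall fun x ↦ (Real.norm_eq_abs _).le.trans <| (hB s (c • x)).trans <|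
      le_of_eq (by rw [norm_smul, Real.norm_of_nonneg hc]; ring))
  have hF₁ : Integrable (fun x ↦ expNegSum θ (s + c • x) - expNegSum θ s) μ :=
    hF.sub (integrable_const _)
  have hF₂ : Integrable (fun x ↦ expNegSum θ (s + c • x) - expNegSum θ s
      - ∑ i, -(θ₁ (s i) * expNegSum θ s) * (c • x) i) μ := hF₁.sub hA
  rw [integral_sub hF₂ hH, integral_sub hF₁ hA, integral_sub hF (integrable_const _),
    integral_finsetSum _ (fun i _ ↦ hA' i), integral_div,
    integral_finsetSum _ (fun i _ ↦ integrable_finsetSum _ fun j _ ↦ hH' i j)] at key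
  have e1 (i : ι) : ∫ x : ι → ℝ, -(θ₁ (s i) * expNegSum θ s) * (c • x) i ∂μ = 0 := by
    simp only [Pi.smul_apply, smul_eq_mul, integral_const_mul, hμ, mul_zero]
  have e2 (i : ι) :
      ∫ x : ι → ℝ, ∑ j, expNegSumHess θ θ₁ θ₂ s i j * ((c • x) i * (c • x) j) ∂μ
        = ∑ j, c ^ 2 * (expNegSumHess θ θ₁ θ₂ s i j * ∫ x, x i * x j ∂μ) := by
    rw [integral_finsetSum _ fun j _ ↦ hH' i j]
    refine Finset.sum_congr rfl fun j _ ↦ ?_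
    simp only [← integral_const_mul]
    congr with x
    simp only [Pi.smul_apply, smul_eq_mul]
    ring
  simp only [e1, e2, Finset.sum_const_zero, ← Finset.mul_sum, integral_const_mul, Real.norm_eq_abs,
    integral_const, probReal_univ, one_smul, sub_zero] at key
  rw [show B * (∫ x : ι → ℝ, ‖x‖ ^ 3 ∂μ) * c ^ 3 = B * c ^ 3 * ∫ x : ι → ℝ, ‖x‖ ^ 3 ∂μ by ring]
  convert key using 3
  ring

/-- A centered Gaussian measure is stable: the sum of two independent copies is a dilation by
`√2`. -/
lemma IsGaussian.conv_self_eq_map_smul (μ : Measure (ι → ℝ)) [IsGaussian μ]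
    (hμ : ∀ i, ∫ x, x i ∂μ = 0) : μ ∗ μ = μ.map (fun x ↦ √2 • x) := by
  have hmean : ∫ x, x ∂μ = 0 := by
    ext i
    rw [eval_integral fun i ↦ ?_]
    · exact hμ i
    · exact IsGaussian.integrable_dual μ (ContinuousLinearMap.proj i)
  have hmap : μ.map (fun x ↦ √2 • x) = μ.map ((√2 : ℝ) • ContinuousLinearMap.id ℝ (ι → ℝ)) := rfl
  have : IsProbabilityMeasure (μ.map (fun x ↦ √2 • x)) :=
    Measure.isProbabilityMeasure_map (by fun_prop)
  refine Measure.ext_of_charFunDual ?_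
  ext L
  rw [charFunDual_conv, hmap, IsGaussian.charFunDual_eq, IsGaussian.charFunDual_eq,
    integral_complex_ofReal, integral_complex_ofReal, IsGaussian.integral_dual,
    IsGaussian.integral_dual, ← hmap, integral_map (by fun_prop) (by fun_prop), integral_smul,
    hmean, smul_zero, variance_map (by fun_prop) (by fun_prop), ← Complex.exp_add]
  have : (L ∘ fun x ↦ √2 • x) = fun x ↦ √2 * L x := by
    ext x
    simp
  rw [this, variance_const_mul]
  simp only [Complex.ofReal_zero, map_zero, zero_mul, zero_sub, Nat.ofNat_nonneg, Real.sq_sqrt,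
    Complex.ofReal_mul, Complex.ofReal_ofNat]
  congr 1
  ring

/-- **Slepian's inequality** for the smooth surrogate of the orthant indicator. -/
lemma IsSmoothStep.integral_expNegSum_le (h : IsSmoothStep θ θ₁ θ₂ θ₃ M)
    (μ ν : Measure (ι → ℝ)) [IsGaussian μ] [IsGaussian ν]
    (hμ : ∀ i, ∫ x, x i ∂μ = 0) (hν : ∀ i, ∫ x, x i ∂ν = 0)
    (hdiag : ∀ i, ∫ x, x i * x i ∂ν = ∫ x, x i * x i ∂μ)
    (hoff : ∀ i j, ∫ x, x i * x j ∂ν ≤ ∫ x, x i * x j ∂μ) :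
    ∫ x, expNegSum θ x ∂ν ≤ ∫ x, expNegSum θ x ∂μ := by
  obtain ⟨Kμ, hKμ0, hKμ⟩ := h.exists_integral_taylor μ hμ
  obtain ⟨Kν, hKν0, hKν⟩ := h.exists_integral_taylor ν hν
  have hcont := h.continuous_expNegSum (ι := ι)
  have hbd (x : ι → ℝ) : ‖expNegSum θ x‖ ≤ 1 := by
    rw [Real.norm_eq_abs, abs_of_nonneg (expNegSum_nonneg _)]
    exact expNegSum_le_one h.nonneg _
  set K := Kμ + Kν
  have small (c : ℝ) (hc : 0 ≤ c) (s : ι → ℝ) :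
      ∫ x, expNegSum θ (s + c • x) ∂ν ≤ ∫ x, expNegSum θ (s + c • x) ∂μ + K * c ^ 3 := by
    have h1 := (abs_le.1 (hKμ c hc s)).1
    have h2 := (abs_le.1 (hKν c hc s)).2
    have h3 : ∑ i, ∑ j, expNegSumHess θ θ₁ θ₂ s i j * ∫ x, x i * x j ∂ν ≤
        ∑ i, ∑ j, expNegSumHess θ θ₁ θ₂ s i j * ∫ x, x i * x j ∂μ := by
      refine Finset.sum_le_sum fun i _ ↦ Finset.sum_le_sum fun j _ ↦ ?_
      rcases eq_or_ne i j with rfl | hij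
      · rw [hdiag]
      · refine mul_le_mul_of_nonneg_left (hoff i j) ?_
        simp only [expNegSumHess, hij, if_false, sub_zero]
        exact mul_nonneg (mul_nonneg (h.deriv_nonneg _) (h.deriv_nonneg _)) (expNegSum_nonneg _)
    have h4 := mul_le_mul_of_nonneg_left h3 (show 0 ≤ c ^ 2 / 2 by positivity)
    have h5 : K * c ^ 3 = Kμ * c ^ 3 + Kν * c ^ 3 := add_mul _ _ _
    linarith
  have dbl (ρ : Measure (ι → ℝ)) [IsGaussian ρ] (hρ : ∀ i, ∫ x, x i ∂ρ = 0) (c : ℝ) (s : ι → ℝ) :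
      ∫ x, expNegSum θ (s + (√2 * c) • x) ∂ρ =
        ∫ x, ∫ y, expNegSum θ (s + c • x + c • y) ∂ρ ∂ρ := by
    have h1 : ∫ x, expNegSum θ (s + c • x) ∂(ρ ∗ ρ) =
        ∫ x, expNegSum θ (s + (√2 * c) • x) ∂ρ := by
      rw [IsGaussian.conv_self_eq_map_smul ρ hρ, integral_map (by fun_prop) (by fun_prop)]
      simp only [smul_smul, mul_comm]
    rw [← h1, integral_conv]
    · simp only [smul_add, add_assoc]
    · exact Integrable.of_bound (C := 1) (by fun_prop) (Filter.Eventually.of_forall fun x ↦ hbd _)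
  have hi (ρ : Measure (ι → ℝ)) [IsGaussian ρ] (s : ι → ℝ) (c : ℝ) :
      Integrable (fun y ↦ expNegSum θ (s + c • y)) ρ :=
    Integrable.of_bound (C := 1) (by fun_prop) (Filter.Eventually.of_forall fun x ↦ hbd _)
  have hii (ρ ρ' : Measure (ι → ℝ)) [IsGaussian ρ] [IsGaussian ρ'] (s : ι → ℝ) (c : ℝ) :
      Integrable (fun p : (ι → ℝ) × (ι → ℝ) ↦ expNegSum θ (s + c • p.1 + c • p.2)) (ρ.prod ρ') :=
    Integrable.of_bound (C := 1) (by fun_prop) (Filter.Eventually.of_forall fun x ↦ hbd _)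
  have double (c D : ℝ)
      (hD : ∀ s : ι → ℝ,
        ∫ x, expNegSum θ (s + c • x) ∂ν ≤ ∫ x, expNegSum θ (s + c • x) ∂μ + D) (s : ι → ℝ) :
      ∫ x, expNegSum θ (s + (√2 * c) • x) ∂ν ≤
        ∫ x, expNegSum θ (s + (√2 * c) • x) ∂μ + 2 * D := by
    rw [dbl ν hν, dbl μ hμ]
    have h1 : ∫ x, ∫ y, expNegSum θ (s + c • x + c • y) ∂ν ∂ν ≤
        ∫ x, (∫ y, expNegSum θ (s + c • x + c • y) ∂μ + D) ∂ν :=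
      integral_mono (hii ν ν s c).integral_prod_left
        ((hii ν μ s c).integral_prod_left.add (integrable_const _)) fun x ↦ hD _
    have h2 : ∫ x, ∫ y, expNegSum θ (s + c • x + c • y) ∂μ ∂ν =
        ∫ y, ∫ x, expNegSum θ (s + c • y + c • x) ∂ν ∂μ := by
      rw [integral_integral_swap (hii ν μ s c)]
      simp only [add_right_comm]
    have h3 : ∫ y, ∫ x, expNegSum θ (s + c • y + c • x) ∂ν ∂μ ≤
        ∫ y, (∫ x, expNegSum θ (s + c • y + c • x) ∂μ + D) ∂μ :=
      integral_mono (hii μ ν s c).integral_prod_left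
        ((hii μ μ s c).integral_prod_left.add (integrable_const _)) fun x ↦ hD _
    rw [integral_add (hii ν μ s c).integral_prod_left (integrable_const _), h2] at h1
    rw [integral_add (hii μ μ s c).integral_prod_left (integrable_const _)] at h3
    simp only [integral_const, probReal_univ, one_smul] at h1 h3
    linarith
  have iter (k : ℕ) (c : ℝ) (hc : 0 ≤ c) (s : ι → ℝ) :
      ∫ x, expNegSum θ (s + (√2 ^ k * c) • x) ∂ν ≤
        ∫ x, expNegSum θ (s + (√2 ^ k * c) • x) ∂μ + 2 ^ k * (K * c ^ 3) := by
    induction k generalizing s with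
    | zero => simpa using small c hc s
    | succ k ih =>
      have := double _ _ ih s
      rw [pow_succ' √2, pow_succ' (2 : ℝ), mul_assoc, mul_assoc]
      exact this
  have h2 : √2 ≠ 0 := by positivity
  have hlim : Filter.Tendsto (fun k : ℕ ↦ ∫ x, expNegSum θ x ∂μ + K * (√2)⁻¹ ^ k) Filter.atTop
      (nhds (∫ x, expNegSum θ x ∂μ)) := by
    have := (tendsto_pow_atTop_nhds_zero_of_lt_one (r := (√2)⁻¹) (by positivity)
      (inv_lt_one_of_one_lt₀ (by rw [Real.lt_sqrt] <;> norm_num))).const_mul K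
    simpa using this.const_add (∫ x, expNegSum θ x ∂μ)
  refine ge_of_tendsto' hlim fun k ↦ ?_
  have := iter k ((√2)⁻¹ ^ k) (by positivity) 0
  rw [← mul_pow, mul_inv_cancel₀ h2, one_pow] at this
  simp only [one_smul, zero_add] at this
  refine this.trans_eq ?_
  have h22 : (2 : ℝ) = √2 * √2 := by simp
  have : (2 : ℝ) ^ k * ((√2)⁻¹ ^ k) ^ 3 = (√2)⁻¹ ^ k := by
    rw [← pow_mul, mul_comm k 3, pow_mul, ← mul_pow]
    congr 1
    nth_rw 1 [h22]
    field_simp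
  linear_combination K * this

/-- **Slepian's inequality** for finitely many coordinates. -/
theorem slepian_measure (μ ν : Measure (ι → ℝ)) [IsGaussian μ] [IsGaussian ν]
    (hμ : ∀ i, ∫ x, x i ∂μ = 0) (hν : ∀ i, ∫ x, x i ∂ν = 0)
    (hdiag : ∀ i, ∫ x, x i * x i ∂ν = ∫ x, x i * x i ∂μ)
    (hoff : ∀ i j, ∫ x, x i * x j ∂ν ≤ ∫ x, x i * x j ∂μ) (u : ℝ) :
    ν {x | ∀ i, x i ≤ u} ≤ μ {x | ∀ i, x i ≤ u} := by
  let A : Set (ι → ℝ) := {x | ∀ i, x i ≤ u}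
  have hA : MeasurableSet A := by
    simp only [A, ofPred_forall]
    exact MeasurableSet.iInter fun i ↦ measurableSet_le (measurable_pi_apply i) measurable_const
  let θ : ℕ → ℝ → ℝ := fun k x ↦ k * Real.smoothTransition (x - u)
  have hstep (k : ℕ) := exists_isSmoothStep k u k.cast_nonneg
  have hlim (ρ : Measure (ι → ℝ)) [IsProbabilityMeasure ρ] :
      Filter.Tendsto (fun k ↦ ∫ x, expNegSum (θ k) x ∂ρ) Filter.atTop (nhds (ρ.real A)) := by
    rw [← integral_indicator_one hA]
    refine tendsto_integral_of_dominated_convergence (fun _ ↦ 1) (fun k ↦ ?_)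
      (integrable_const _) (fun k ↦ Filter.Eventually.of_forall fun x ↦ ?_)
      (Filter.Eventually.of_forall fun x ↦ ?_)
    · obtain ⟨_, _, _, _, h⟩ := hstep k
      exact h.continuous_expNegSum.aestronglyMeasurable
    · obtain ⟨_, _, _, _, h⟩ := hstep k
      rw [Real.norm_eq_abs, abs_of_nonneg (expNegSum_nonneg _)]
      exact expNegSum_le_one h.nonneg _
    · have hx (k : ℕ) : expNegSum (θ k) x =
          Real.exp (-∑ i, Real.smoothTransition (x i - u)) ^ k := by
        rw [← Real.exp_nat_mul]
        simp [expNegSum, θ, Finset.mul_sum]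
      simp only [hx]
      by_cases hxA : x ∈ A
      · have : ∑ i, Real.smoothTransition (x i - u) = 0 :=
          Finset.sum_eq_zero fun i _ ↦
            Real.smoothTransition.zero_of_nonpos (sub_nonpos.2 (hxA i))
        simp [this, hxA]
      · rw [indicator_of_notMem hxA]
        obtain ⟨i, hi⟩ : ∃ i, u < x i := by simpa [A] using hxA
        refine tendsto_pow_atTop_nhds_zero_of_lt_one (Real.exp_pos _).le ?_
        rw [Real.exp_lt_one_iff, neg_lt_zero]
        exact Finset.sum_pos' (fun _ _ ↦ Real.smoothTransition.nonneg _)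
          ⟨i, Finset.mem_univ _, Real.smoothTransition.pos_of_pos (sub_pos.2 hi)⟩
  have hreal : ν.real A ≤ μ.real A := by
    refine le_of_tendsto_of_tendsto' (hlim ν) (hlim μ) fun k ↦ ?_
    obtain ⟨_, _, _, _, h⟩ := hstep k
    exact h.integral_expNegSum_le μ ν hμ hν hdiag hoff
  exact (ENNReal.toReal_le_toReal (measure_ne_top _ _) (measure_ne_top _ _)).1 hreal

end Slepian

lemma measure_forall_le_eq_iInf {U : Type*} [MeasurableSpace U] (ρ : Measure U)
    [IsProbabilityMeasure ρ] (Z : ℕ → U → ℝ) (hZ : ∀ i, Measurable (Z i)) (u : ℝ) :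
    ρ {x | ∀ i, Z i x ≤ u} = ⨅ k : ℕ, ρ {x | ∀ i < k, Z i x ≤ u} := by
  have hset : {x | ∀ i, Z i x ≤ u} = ⋂ k : ℕ, {x | ∀ i < k, Z i x ≤ u} := by
    ext x
    simp only [mem_ofPred_eq, mem_iInter]
    exact ⟨fun h _ i _ ↦ h i, fun h i ↦ h (i + 1) i i.lt_succ_self⟩
  rw [hset]
  refine Antitone.measure_iInter (fun a b hab x hx i hi ↦ hx i (hi.trans_le hab)) (fun k ↦ ?_)
    ⟨0, measure_ne_top _ _⟩
  simp only [ofPred_forall]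
  exact (MeasurableSet.iInter fun i ↦ MeasurableSet.iInter fun _ ↦
    measurableSet_le (hZ i) measurable_const).nullMeasurableSet

/-- **Slepian's inequality** for a sequence of centered linear functionals on Gaussian spaces. -/
theorem slepian_dual {V W : Type*} [NormedAddCommGroup V] [NormedSpace ℝ V] [MeasurableSpace V]
    [BorelSpace V] [NormedAddCommGroup W] [NormedSpace ℝ W] [MeasurableSpace W] [BorelSpace W]
    (P : Measure V) (Q : Measure W) [IsGaussian P] [IsGaussian Q]
    (X : ℕ → StrongDual ℝ V) (Y : ℕ → StrongDual ℝ W)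
    (hX : ∀ i, ∫ v, X i v ∂P = 0) (hY : ∀ i, ∫ w, Y i w ∂Q = 0)
    (hdiag : ∀ i, ∫ w, Y i w * Y i w ∂Q = ∫ v, X i v * X i v ∂P)
    (hoff : ∀ i j, ∫ w, Y i w * Y j w ∂Q ≤ ∫ v, X i v * X j v ∂P) (u : ℝ) :
    Q {w | ∀ i, Y i w ≤ u} ≤ P {v | ∀ i, X i v ≤ u} := by
  have hfin (k : ℕ) : Q {w | ∀ i < k, Y i w ≤ u} ≤ P {v | ∀ i < k, X i v ≤ u} := by
    let LX : V →L[ℝ] (Fin k → ℝ) := ContinuousLinearMap.pi fun i ↦ X i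
    let LY : W →L[ℝ] (Fin k → ℝ) := ContinuousLinearMap.pi fun i ↦ Y i
    have hmeas : MeasurableSet {x : Fin k → ℝ | ∀ i, x i ≤ u} := by
      simp only [ofPred_forall]
      exact MeasurableSet.iInter fun i ↦ measurableSet_le (measurable_pi_apply i) measurable_const
    have hLX : Measurable LX := LX.continuous.measurable
    have hLY : Measurable LY := LY.continuous.measurable
    have := slepian_measure (P.map LX) (Q.map LY)
      (fun i ↦ by
        rw [integral_map hLX.aemeasurable (measurable_pi_apply i).aestronglyMeasurable]
        exact hX i)
      (fun i ↦ by
        rw [integral_map hLY.aemeasurable (measurable_pi_apply i).aestronglyMeasurable]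
        exact hY i)
      (fun i ↦ by
        rw [integral_map hLX.aemeasurable (by fun_prop),
          integral_map hLY.aemeasurable (by fun_prop)]
        exact hdiag i)
      (fun i j ↦ by
        rw [integral_map hLX.aemeasurable (by fun_prop),
          integral_map hLY.aemeasurable (by fun_prop)]
        exact hoff i j) u
    rw [Measure.map_apply hLX hmeas, Measure.map_apply hLY hmeas] at this
    convert this using 2
    · ext w
      simp [LY, Fin.forall_iff]
    · ext v
      simp [LX, Fin.forall_iff]
  rw [measure_forall_le_eq_iInf Q (fun i ↦ Y i) fun i ↦ (Y i).continuous.measurable,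
    measure_forall_le_eq_iInf P (fun i ↦ X i) fun i ↦ (X i).continuous.measurable]
  exact iInf_mono hfin

section Moments

lemma integral_add_prod_eq_zero {V W : Type*} [MeasurableSpace V] [MeasurableSpace W]
    {P : Measure V} {Q : Measure W} [IsProbabilityMeasure P] [IsProbabilityMeasure Q]
    {a : V → ℝ} {b : W → ℝ} (ha : MemLp a 2 P) (hb : MemLp b 2 Q)
    (ha0 : ∫ v, a v ∂P = 0) (hb0 : ∫ w, b w ∂Q = 0) :
    ∫ p, (a p.1 + b p.2) ∂(P.prod Q) = 0 := by
  rw [integral_add ((ha.integrable (by norm_num)).comp_fst Q)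
    ((hb.integrable (by norm_num)).comp_snd P), integral_fun_fst, integral_fun_snd]
  simp [ha0, hb0]

lemma integral_add_mul_add_prod {V W : Type*} [MeasurableSpace V] [MeasurableSpace W]
    {P : Measure V} {Q : Measure W} [IsProbabilityMeasure P] [IsProbabilityMeasure Q]
    {a a' : V → ℝ} {b b' : W → ℝ} (ha : MemLp a 2 P) (ha' : MemLp a' 2 P)
    (hb : MemLp b 2 Q) (hb' : MemLp b' 2 Q)
    (ha0 : ∫ v, a v ∂P = 0) (ha0' : ∫ v, a' v ∂P = 0) :
    ∫ p, (a p.1 + b p.2) * (a' p.1 + b' p.2) ∂(P.prod Q) =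
      ∫ v, a v * a' v ∂P + ∫ w, b w * b' w ∂Q := by
  have i1 := ha.integrable (q := 2) (by norm_num)
  have i1' := ha'.integrable (q := 2) (by norm_num)
  have i2 := hb.integrable (q := 2) (by norm_num)
  have i2' := hb'.integrable (q := 2) (by norm_num)
  have j1 : Integrable (fun p : V × W ↦ a p.1 * a' p.1) (P.prod Q) :=
    (ha.integrable_mul ha').comp_fst Q
  have j2 : Integrable (fun p : V × W ↦ b p.2 * b' p.2) (P.prod Q) :=
    (hb.integrable_mul hb').comp_snd P
  have j3 : Integrable (fun p : V × W ↦ a p.1 * b' p.2) (P.prod Q) := i1.mul_prod i2'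
  have j4 : Integrable (fun p : V × W ↦ a' p.1 * b p.2) (P.prod Q) := i1'.mul_prod i2
  have hexp : (fun p : V × W ↦ (a p.1 + b p.2) * (a' p.1 + b' p.2)) = fun p ↦
      (a p.1 * a' p.1 + b p.2 * b' p.2) + (a p.1 * b' p.2 + a' p.1 * b p.2) := by
    ext p
    ring
  have j12 : Integrable (fun p : V × W ↦ a p.1 * a' p.1 + b p.2 * b' p.2) (P.prod Q) := j1.add j2
  have j34 : Integrable (fun p : V × W ↦ a p.1 * b' p.2 + a' p.1 * b p.2) (P.prod Q) := j3.add j4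
  rw [hexp, integral_add j12 j34, integral_add j1 j2, integral_add j3 j4, integral_prod_mul,
    integral_prod_mul, ha0, ha0', integral_fun_fst (fun v ↦ a v * a' v),
    integral_fun_snd (fun w ↦ b w * b' w)]
  simp

variable {ι V : Type*} [Fintype ι] [MeasurableSpace V] {P : Measure V} [IsProbabilityMeasure P]
  {a a' : ι → V → ℝ}

lemma memLp_comp_eval (ha : ∀ i, MemLp (a i) 2 P) (i : ι) :
    MemLp (fun z : ι → V ↦ a i (z i)) 2 (Measure.pi fun _ : ι ↦ P) :=
  (ha i).comp_measurePreserving (measurePreserving_eval (fun _ : ι ↦ P) i)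

lemma integral_sum_pi_eq_zero (ha : ∀ i, MemLp (a i) 2 P) (ha0 : ∀ i, ∫ v, a i v ∂P = 0) :
    ∫ z, ∑ i, a i (z i) ∂(Measure.pi fun _ : ι ↦ P) = 0 := by
  rw [integral_finsetSum _ fun i _ ↦ (memLp_comp_eval ha i).integrable (by norm_num)]
  refine Finset.sum_eq_zero fun i _ ↦ ?_
  rw [integral_comp_eval (μ := fun _ : ι ↦ P) (f := a i) (ha i).aestronglyMeasurable, ha0]

lemma integral_sum_mul_sum_pi (ha : ∀ i, MemLp (a i) 2 P) (ha' : ∀ i, MemLp (a' i) 2 P)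
    (ha0 : ∀ i, ∫ v, a i v ∂P = 0) :
    ∫ z, (∑ i, a i (z i)) * (∑ i, a' i (z i)) ∂(Measure.pi fun _ : ι ↦ P) =
      ∑ i, ∫ v, a i v * a' i v ∂P := by
  have hint (i j : ι) :
      Integrable (fun z : ι → V ↦ a i (z i) * a' j (z j)) (Measure.pi fun _ : ι ↦ P) :=
    (memLp_comp_eval ha i).integrable_mul (memLp_comp_eval ha' j)
  simp only [Finset.sum_mul_sum]
  rw [integral_finsetSum _ fun i _ ↦ integrable_finsetSum _ fun j _ ↦ hint i j]
  refine Finset.sum_congr rfl fun i _ ↦ ?_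
  rw [integral_finsetSum _ fun j _ ↦ hint i j, Finset.sum_eq_single i]
  · exact integral_comp_eval (μ := fun _ : ι ↦ P) (f := fun v ↦ a i v * a' i v)
      ((ha i).aestronglyMeasurable.mul (ha' i).aestronglyMeasurable)
  · intro j _ hji
    have hind : IndepFun (fun z : ι → V ↦ a i (z i)) (fun z : ι → V ↦ a' j (z j))
        (Measure.pi fun _ : ι ↦ P) :=
      ((iIndepFun_pi (X := fun _ (v : V) ↦ v) (μ := fun _ : ι ↦ P)
        fun _ ↦ aemeasurable_id).indepFun hji.symm).comp₀
        (measurable_pi_apply i).aemeasurable (measurable_pi_apply j).aemeasurable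
        (by rw [(measurePreserving_eval (fun _ : ι ↦ P) i).map_eq]; exact (ha i).aemeasurable)
        (by rw [(measurePreserving_eval (fun _ : ι ↦ P) j).map_eq]; exact (ha' j).aemeasurable)
    have h0 : ∫ z : ι → V, a i (z i) ∂(Measure.pi fun _ : ι ↦ P) = 0 := by
      rw [integral_comp_eval (μ := fun _ : ι ↦ P) (f := a i) (ha i).aestronglyMeasurable, ha0]
    rw [hind.integral_fun_mul_eq_mul_integral (memLp_comp_eval ha i).aestronglyMeasurable
      (memLp_comp_eval ha' j).aestronglyMeasurable, h0, zero_mul]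
  · simp

end Moments

/-- Products of Gaussian measures are Gaussian. -/
lemma isGaussian_pi {ι V : Type*} [Fintype ι] [NormedAddCommGroup V] [NormedSpace ℝ V]
    [MeasurableSpace V] [BorelSpace V] [SecondCountableTopology V] [CompleteSpace V]
    (P : Measure V) [IsGaussian P] : IsGaussian (Measure.pi fun _ : ι ↦ P) := by
  have h := iIndepFun.hasGaussianLaw (P := Measure.pi fun _ : ι ↦ P)
    (X := fun (i : ι) (z : ι → V) ↦ z i)
    (fun i ↦ ⟨by
      rw [(measurePreserving_eval (fun _ : ι ↦ P) i).map_eq]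
      infer_instance⟩)
    (iIndepFun_pi (X := fun _ (v : V) ↦ v) (μ := fun _ : ι ↦ P) fun _ ↦ aemeasurable_id)
  have := h.isGaussian_map
  rwa [show (fun (ω : ι → V) ↦ (fun i ↦ ω i)) = id from rfl, Measure.map_id] at this

/-- Symmetrization: a convex function is at most its Gaussian average. -/
lemma ofReal_le_lintegral_add_gaussian {h : ℝ → ℝ} (hconv : ConvexOn ℝ univ h)
    (hcont : Continuous h) (h0 : ∀ x, 0 ≤ h x) (r : ℝ) :
    ENNReal.ofReal (h r) ≤ ∫⁻ t, ENNReal.ofReal (h (r + t)) ∂(gaussianReal 0 1) := by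
  have hm : Measurable h := hcont.measurable
  have hneg : ∫⁻ t, ENNReal.ofReal (h (r + -t)) ∂(gaussianReal 0 1) =
      ∫⁻ t, ENNReal.ofReal (h (r + t)) ∂(gaussianReal 0 1) := by
    have : (gaussianReal 0 1).map (fun t ↦ -t) = gaussianReal 0 1 := by
      rw [gaussianReal_map_neg, neg_zero]
    conv_rhs => rw [← this]
    rw [lintegral_map (by fun_prop) (by fun_prop)]
  have hpt (t : ℝ) : 2 * ENNReal.ofReal (h r) ≤
      ENNReal.ofReal (h (r + t)) + ENNReal.ofReal (h (r + -t)) := by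
    rw [← ENNReal.ofReal_add (h0 _) (h0 _), show (2 : ENNReal) = ENNReal.ofReal 2 by simp,
      ← ENNReal.ofReal_mul (by norm_num)]
    refine ENNReal.ofReal_le_ofReal ?_
    have := hconv.2 (mem_univ (r + t)) (mem_univ (r + -t))
      (show (0 : ℝ) ≤ 1 / 2 by norm_num) (show (0 : ℝ) ≤ 1 / 2 by norm_num) (by norm_num)
    simp only [smul_eq_mul] at this
    rw [show 1 / 2 * (r + t) + 1 / 2 * (r + -t) = r by ring] at this
    linarith
  have hle := lintegral_mono (μ := gaussianReal 0 1) hpt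
  rw [lintegral_const, measure_univ, mul_one, lintegral_add_left (by fun_prop), hneg,
    ← two_mul] at hle
  exact (ENNReal.mul_le_mul_iff_right (by norm_num) (by norm_num)).1 hle

/-- A nonempty proper open upper set of reals is an open half-line. -/
lemma IsUpperSet.exists_eq_Ioi {U : Set ℝ} (hU : IsUpperSet U) (hopen : IsOpen U)
    (hne : U.Nonempty) (huniv : U ≠ univ) : ∃ u, U = Ioi u := by
  obtain ⟨b, hb⟩ := (ne_univ_iff_exists_notMem U).1 huniv
  have hbdd : BddBelow U := ⟨b, fun s hs ↦ le_of_not_ge fun hsb ↦ hb (hU hsb hs)⟩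
  refine ⟨sInf U, Subset.antisymm (fun s hs ↦ ?_) fun s hs ↦ ?_⟩
  · obtain ⟨l, hl, hlU⟩ := exists_Ioc_subset_of_mem_nhds (hopen.mem_nhds hs) ⟨s - 1, by linarith⟩
    have hmid : (l + s) / 2 ∈ U := hlU ⟨by linarith, by linarith⟩
    have := csInf_le hbdd hmid
    rw [mem_Ioi]
    linarith
  · obtain ⟨s', hs', hlt⟩ := exists_lt_of_csInf_lt hne hs
    exact hU hlt.le hs'

lemma tendsto_integral_max_neg {Ω : Type*} [MeasurableSpace Ω] (ρ : Measure Ω)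
    [IsProbabilityMeasure ρ] (g : Ω → ℝ) (hg : Integrable g ρ) :
    Filter.Tendsto (fun k : ℕ ↦ ∫ a, max (g a) (-k) ∂ρ) Filter.atTop (nhds (∫ a, g a ∂ρ)) := by
  refine tendsto_integral_of_dominated_convergence (fun a ↦ ‖g a‖)
    (fun k ↦ (hg.sup (integrable_const (-k : ℝ))).aestronglyMeasurable) hg.norm
    (fun k ↦ Filter.Eventually.of_forall fun a ↦ ?_) (Filter.Eventually.of_forall fun a ↦ ?_)
  · have hk : (0 : ℝ) ≤ k := k.cast_nonneg
    rw [Real.norm_eq_abs, Real.norm_eq_abs]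
    rcases le_total (g a) (-k) with hgk | hgk
    · rw [max_eq_right hgk, abs_neg, abs_of_nonneg hk]
      linarith [neg_le_abs (g a)]
    · rw [max_eq_left hgk]
  · refine tendsto_const_nhds.congr' ?_
    obtain ⟨N, hN⟩ := exists_nat_ge (-g a)
    filter_upwards [Filter.eventually_ge_atTop N] with k hk
    have : (N : ℝ) ≤ k := by exact_mod_cast hk
    rw [max_eq_left]
    linarith

section Domination

variable {A B : Type*} [MeasurableSpace A] [MeasurableSpace B] {P : Measure A} {Q : Measure B}
  [IsProbabilityMeasure P] [IsProbabilityMeasure Q]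

/-- Stochastic domination implies the inequality of expectations of nonnegative continuous
monotone functions. -/
lemma lintegral_le_of_stochastic_domination {Z : A → ℝ} {W : B → ℝ} (hZ : Measurable Z)
    (hW : Measurable W) (hdom : ∀ u, Q {b | W b ≤ u} ≤ P {a | Z a ≤ u}) {h : ℝ → ℝ}
    (hmono : Monotone h) (hcont : Continuous h) (h0 : ∀ x, 0 ≤ h x) :
    ∫⁻ a, ENNReal.ofReal (h (Z a)) ∂P ≤ ∫⁻ b, ENNReal.ofReal (h (W b)) ∂Q := by
  rw [lintegral_eq_lintegral_meas_lt P (Filter.Eventually.of_forall fun a ↦ h0 _)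
      (hcont.measurable.comp hZ).aemeasurable,
    lintegral_eq_lintegral_meas_lt Q (Filter.Eventually.of_forall fun a ↦ h0 _)
      (hcont.measurable.comp hW).aemeasurable]
  refine lintegral_mono fun t ↦ ?_
  have hup : IsUpperSet {s | t < h s} := fun x y hxy hx ↦ lt_of_lt_of_le hx (hmono hxy)
  have hopen : IsOpen {s | t < h s} := isOpen_lt continuous_const hcont
  change P (Z ⁻¹' {s | t < h s}) ≤ Q (W ⁻¹' {s | t < h s})
  rcases eq_empty_or_nonempty {s | t < h s} with he | hne
  · simp [he]
  by_cases huniv : {s | t < h s} = univ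
  · simp [huniv]
  obtain ⟨u, hu⟩ := hup.exists_eq_Ioi hopen hne huniv
  rw [hu, ← compl_Iic, preimage_compl, preimage_compl,
    prob_compl_eq_one_sub (hZ measurableSet_Iic), prob_compl_eq_one_sub (hW measurableSet_Iic)]
  exact tsub_le_tsub_left (hdom u) 1

/-- If a random variable `W` stochastically dominates `R` plus independent Gaussian noise, then
`E f(R) ≤ E f(W)` for monotone convex `f`. -/
lemma integral_le_of_gaussian_domination {R : A → ℝ} {W : B → ℝ} (hR : Measurable R)
    (hW : Measurable W)
    (hdom : ∀ u, Q {b | W b ≤ u} ≤ (P.prod (gaussianReal 0 1)) {p | R p.1 + p.2 ≤ u})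
    {f : ℝ → ℝ} (hmono : Monotone f) (hconv : ConvexOn ℝ univ f)
    (hfR : Integrable (fun a ↦ f (R a)) P) (hfW : Integrable (fun b ↦ f (W b)) Q) :
    ∫ a, f (R a) ∂P ≤ ∫ b, f (W b) ∂Q := by
  have hcont : Continuous f := by
    simpa [continuousOn_univ] using hconv.continuousOn isOpen_univ
  have hnn {h : ℝ → ℝ} (hmono : Monotone h) (hconv : ConvexOn ℝ univ h) (hcont : Continuous h)
      (h0 : ∀ x, 0 ≤ h x) :
      ∫⁻ a, ENNReal.ofReal (h (R a)) ∂P ≤ ∫⁻ b, ENNReal.ofReal (h (W b)) ∂Q := by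
    have hm := hcont.measurable
    calc ∫⁻ a, ENNReal.ofReal (h (R a)) ∂P
        ≤ ∫⁻ a, ∫⁻ t, ENNReal.ofReal (h (R a + t)) ∂(gaussianReal 0 1) ∂P :=
          lintegral_mono fun a ↦ ofReal_le_lintegral_add_gaussian hconv hcont h0 _
      _ = ∫⁻ p, ENNReal.ofReal (h (R p.1 + p.2)) ∂(P.prod (gaussianReal 0 1)) :=
          by rw [lintegral_prod _ (by fun_prop)]
      _ ≤ ∫⁻ b, ENNReal.ofReal (h (W b)) ∂Q :=
          lintegral_le_of_stochastic_domination (by fun_prop) hW hdom hmono hcont h0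
  have htrunc (k : ℕ) : ∫ a, max (f (R a)) (-k) ∂P ≤ ∫ b, max (f (W b)) (-k) ∂Q := by
    have h0 (x : ℝ) : 0 ≤ max (f x) (-k) + k := by linarith [le_max_right (f x) (-k : ℝ)]
    have hle := hnn (h := fun x ↦ max (f x) (-k) + k)
      (fun x y hxy ↦ by have := hmono hxy; dsimp only; gcongr)
      ((hconv.sup (convexOn_const _ convex_univ)).add (convexOn_const _ convex_univ))
      (by fun_prop) h0
    have iR : Integrable (fun a ↦ max (f (R a)) (-k : ℝ)) P := hfR.sup (integrable_const _)
    have iW : Integrable (fun b ↦ max (f (W b)) (-k : ℝ)) Q := hfW.sup (integrable_const _)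
    have iR' : Integrable (fun a ↦ max (f (R a)) (-k : ℝ) + k) P := iR.add (integrable_const _)
    have iW' : Integrable (fun b ↦ max (f (W b)) (-k : ℝ) + k) Q := iW.add (integrable_const _)
    rw [← ofReal_integral_eq_lintegral_ofReal iR'
        (Filter.Eventually.of_forall fun a ↦ h0 _),
      ← ofReal_integral_eq_lintegral_ofReal iW'
        (Filter.Eventually.of_forall fun a ↦ h0 _),
      ENNReal.ofReal_le_ofReal_iff (integral_nonneg fun b ↦ h0 _),
      integral_add iR (integrable_const _), integral_add iW (integrable_const _)] at hle
    simpa using hle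
  exact le_of_tendsto_of_tendsto' (tendsto_integral_max_neg P _ hfR)
    (tendsto_integral_max_neg Q _ hfW) htrunc

end Domination

section Cone

variable {k : ℕ} {D : Set (Euc k)}

lemma IsClosedConvexCone.metricProj_spec (hD : IsClosedConvexCone D) (y : Euc k) :
    metricProj D y ∈ D ∧ ∀ w ∈ D, ⟪y - metricProj D y, w - metricProj D y⟫_ℝ ≤ 0 := by
  obtain ⟨hclosed, hconv, -, h0⟩ := hD
  have hex : ∃ z, z ∈ D ∧ ∀ w ∈ D, dist y z ≤ dist y w := by
    obtain ⟨z, hz, hzy⟩ := hclosed.exists_infDist_eq_dist ⟨0, h0⟩ y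
    exact ⟨z, hz, fun w hw ↦ hzy ▸ infDist_le_dist_of_mem hw⟩
  rw [metricProj, dif_pos hex]
  obtain ⟨hz, hmin⟩ := hex.choose_spec
  refine ⟨hz, (norm_eq_iInf_iff_real_inner_le_zero hconv hz).1 ?_⟩
  have : Nonempty D := ⟨⟨0, h0⟩⟩
  refine le_antisymm (le_ciInf fun w ↦ ?_)
    (ciInf_le (f := fun w : D ↦ ‖y - w‖) ⟨0, ?_⟩ ⟨_, hz⟩)
  · simpa [dist_eq_norm] using hmin w w.2
  · rintro _ ⟨w, rfl⟩
    exact norm_nonneg _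

lemma IsClosedConvexCone.inner_sub_metricProj_self (hD : IsClosedConvexCone D) (y : Euc k) :
    ⟪y - metricProj D y, metricProj D y⟫_ℝ = 0 := by
  obtain ⟨hp, hle⟩ := hD.metricProj_spec y
  have h0 := hle 0 hD.2.2.2
  have h2 := hle _ (hD.2.2.1 2 (by norm_num) _ hp)
  rw [zero_sub, inner_neg_right] at h0
  rw [two_smul, add_sub_cancel_right] at h2
  linarith

lemma IsClosedConvexCone.inner_sub_metricProj_le (hD : IsClosedConvexCone D) (y : Euc k)
    {z : Euc k} (hz : z ∈ D) : ⟪y - metricProj D y, z⟫_ℝ ≤ 0 := by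
  have h := (hD.metricProj_spec y).2 z hz
  rwa [inner_sub_right, hD.inner_sub_metricProj_self, sub_zero] at h

/-- The norm of the projection onto a cone is the support function of the cone's unit ball. -/
lemma IsClosedConvexCone.norm_metricProj_le_iff (hD : IsClosedConvexCone D) (y : Euc k) (u : ℝ) :
    ‖metricProj D y‖ ≤ u ↔ ∀ z ∈ D ∩ closedBall 0 1, ⟪z, y⟫_ℝ ≤ u := by
  have hself : ⟪metricProj D y, y⟫_ℝ = ‖metricProj D y‖ ^ 2 := by
    have := hD.inner_sub_metricProj_self y
    rw [inner_sub_left, real_inner_self_eq_norm_sq, real_inner_comm] at this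
    linarith
  have hp := (hD.metricProj_spec y).1
  have hle {z : Euc k} (hz : z ∈ D) := hD.inner_sub_metricProj_le y hz
  generalize metricProj D y = p at *
  refine ⟨fun h z hz ↦ ?_, fun h ↦ ?_⟩
  · have h1 := hle hz.1
    have h2 := real_inner_le_norm p z
    have h3 : ‖z‖ ≤ 1 := by simpa using hz.2
    have h4 := mul_le_mul_of_nonneg_left h3 (norm_nonneg p)
    rw [inner_sub_left] at h1
    rw [real_inner_comm]
    linarith
  · rcases eq_or_ne p 0 with rfl | hne
    · simpa using h 0 ⟨hD.2.2.2, by simp⟩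
    · have hpos : 0 < ‖p‖ := norm_pos_iff.2 hne
      have := h (‖p‖⁻¹ • p) ⟨hD.2.2.1 _ (by positivity) _ hp, by
        simp [norm_smul, hpos.ne']⟩
      rw [real_inner_smul_left, hself] at this
      field_simp at this
      linarith

lemma IsClosedConvexCone.measurable_norm_metricProj (hD : IsClosedConvexCone D) :
    Measurable fun y ↦ ‖metricProj D y‖ := by
  refine measurable_of_Iic fun u ↦ IsClosed.measurableSet ?_
  have : (fun y ↦ ‖metricProj D y‖) ⁻¹' Iic u =
      ⋂ z ∈ D ∩ closedBall 0 1, {y | ⟪z, y⟫_ℝ ≤ u} := by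
    ext y
    simp [-mem_inter_iff, hD.norm_metricProj_le_iff]
  rw [this]
  exact isClosed_biInter fun z _ ↦ isClosed_le (by fun_prop) continuous_const

end Cone

section ResNorm

variable {m n : ℕ} {C : Set (Euc m)} {D : Set (Euc n)}

lemma inner_mulE (G : Fin n → Fin m → ℝ) (x : Euc m) (y : Euc n) :
    ⟪y, mulE (Matrix.of G) x⟫_ℝ = ∑ i, ∑ j, (x j * y i) * G i j := by
  simp only [mulE, PiLp.inner_apply, Matrix.toLpLin_apply, Matrix.mulVec, dotProduct,
    RCLike.inner_apply, conj_trivial, Matrix.of_apply, Finset.sum_mul]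
  refine Finset.sum_congr rfl fun i _ ↦ Finset.sum_congr rfl fun j _ ↦ ?_
  ring

lemma IsClosedConvexCone.inter_sphere_nonempty (hC : IsClosedConvexCone C) (hCne : C ≠ {0}) :
    (C ∩ sphere 0 1).Nonempty := by
  obtain ⟨x, hx, hx0⟩ : ∃ x ∈ C, x ≠ 0 := by
    by_contra! h
    exact hCne (Subset.antisymm h (by simpa using hC.2.2.2))
  have hpos : 0 < ‖x‖ := norm_pos_iff.2 hx0
  exact ⟨‖x‖⁻¹ • x, hC.2.2.1 _ (by positivity) _ hx, by simp [norm_smul, hpos.ne']⟩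

lemma resNorm_le_iff (hC : IsClosedConvexCone C) (hCne : C ≠ {0}) (hD : IsClosedConvexCone D)
    (A : Matrix (Fin n) (Fin m) ℝ) (u : ℝ) :
    resNorm C D A ≤ u ↔
      ∀ x ∈ C ∩ sphere 0 1, ∀ z ∈ D ∩ closedBall 0 1, ⟪z, mulE A x⟫_ℝ ≤ u := by
  have hbdd : BddAbove ((fun x ↦ ‖metricProj D (mulE A x)‖) '' (C ∩ sphere 0 1)) := by
    refine ⟨‖LinearMap.toContinuousLinearMap (Matrix.toEuclideanLin A)‖, ?_⟩
    rintro _ ⟨x, hx, rfl⟩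
    refine (hD.norm_metricProj_le_iff _ _).2 fun z hz ↦ ?_
    have hz1 : ‖z‖ ≤ 1 := by simpa using hz.2
    have hx1 : ‖x‖ = 1 := by simpa using hx.2
    have h1 := (LinearMap.toContinuousLinearMap (Matrix.toEuclideanLin A)).le_opNorm x
    rw [hx1, mul_one] at h1
    calc ⟪z, mulE A x⟫_ℝ ≤ ‖z‖ * ‖mulE A x‖ := real_inner_le_norm _ _
      _ ≤ 1 * ‖mulE A x‖ := by gcongr
      _ ≤ _ := by rw [one_mul]; exact h1
  rw [resNorm, csSup_le_iff hbdd ((hC.inter_sphere_nonempty hCne).image _), forall_mem_image]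
  simp only [hD.norm_metricProj_le_iff]

lemma measurable_resNorm (hC : IsClosedConvexCone C) (hCne : C ≠ {0})
    (hD : IsClosedConvexCone D) :
    Measurable fun G : Fin n → Fin m → ℝ ↦ resNorm C D (Matrix.of G) := by
  refine measurable_of_Iic fun u ↦ IsClosed.measurableSet ?_
  have : (fun G : Fin n → Fin m → ℝ ↦ resNorm C D (Matrix.of G)) ⁻¹' Iic u =
      ⋂ x ∈ C ∩ sphere 0 1, ⋂ z ∈ D ∩ closedBall 0 1,
        {G | ⟪z, mulE (Matrix.of G) x⟫_ℝ ≤ u} := by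
    ext G
    simp [-mem_inter_iff, resNorm_le_iff hC hCne hD]
  rw [this]
  refine isClosed_biInter fun x _ ↦ isClosed_biInter fun z _ ↦ isClosed_le ?_ continuous_const
  simp only [inner_mulE]
  fun_prop

end ResNorm

section GaussianMoments

lemma memLp_const_mul_gaussianReal (c : ℝ) : MemLp (fun t ↦ c * t) 2 (gaussianReal 0 1) :=
  (memLp_id_gaussianReal 2).const_mul c

lemma integral_const_mul_gaussianReal (c : ℝ) : ∫ t, c * t ∂(gaussianReal 0 1) = 0 := by
  rw [integral_const_mul, integral_id_gaussianReal, mul_zero]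

lemma integral_const_mul_mul_gaussianReal (c c' : ℝ) :
    ∫ t, c * t * (c' * t) ∂(gaussianReal 0 1) = c * c' := by
  have hvar : ∫ t, t ^ 2 ∂(gaussianReal 0 1) = 1 := by
    have h := variance_eq_sub (memLp_id_gaussianReal (μ := 0) (v := 1) 2)
    rw [variance_id_gaussianReal] at h
    simpa [integral_id_gaussianReal] using h.symm
  rw [show (fun t : ℝ ↦ c * t * (c' * t)) = fun t ↦ c * c' * t ^ 2 by ext t; ring,
    integral_const_mul, hvar, mul_one]

variable {ι : Type*} [Fintype ι]

lemma memLp_sum_mul_pi_gaussianReal (c : ι → ℝ) :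
    MemLp (fun z : ι → ℝ ↦ ∑ i, c i * z i) 2 (Measure.pi fun _ : ι ↦ gaussianReal 0 1) :=
  memLp_finsetSum _ fun i _ ↦
    memLp_comp_eval (a := fun i t ↦ c i * t) (fun i ↦ memLp_const_mul_gaussianReal (c i)) i

lemma integral_sum_mul_pi_gaussianReal (c : ι → ℝ) :
    ∫ z : ι → ℝ, ∑ i, c i * z i ∂(Measure.pi fun _ : ι ↦ gaussianReal 0 1) = 0 :=
  integral_sum_pi_eq_zero (a := fun i t ↦ c i * t) (fun i ↦ memLp_const_mul_gaussianReal (c i))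
    fun i ↦ integral_const_mul_gaussianReal (c i)

lemma integral_sum_mul_sum_pi_gaussianReal (c c' : ι → ℝ) :
    ∫ z : ι → ℝ, (∑ i, c i * z i) * (∑ i, c' i * z i)
      ∂(Measure.pi fun _ : ι ↦ gaussianReal 0 1) = ∑ i, c i * c' i := by
  rw [integral_sum_mul_sum_pi (a := fun i t ↦ c i * t) (a' := fun i t ↦ c' i * t)
    (fun i ↦ memLp_const_mul_gaussianReal (c i)) (fun i ↦ memLp_const_mul_gaussianReal (c' i))
    fun i ↦ integral_const_mul_gaussianReal (c i)]
  simp only [integral_const_mul_mul_gaussianReal]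

variable {m n : ℕ}

lemma memLp_inner_mulE (x : Euc m) (y : Euc n) :
    MemLp (fun G ↦ ⟪y, mulE (Matrix.of G) x⟫_ℝ) 2 (stdGaussianPi n m) := by
  simp only [inner_mulE]
  exact memLp_finsetSum _ fun i _ ↦
    memLp_comp_eval (a := fun i (r : Fin m → ℝ) ↦ ∑ j, (x j * y i) * r j)
      (fun i ↦ memLp_sum_mul_pi_gaussianReal fun j ↦ x j * y i) i

lemma integral_inner_mulE (x : Euc m) (y : Euc n) :
    ∫ G, ⟪y, mulE (Matrix.of G) x⟫_ℝ ∂(stdGaussianPi n m) = 0 := by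
  simp only [inner_mulE]
  exact integral_sum_pi_eq_zero (a := fun i (r : Fin m → ℝ) ↦ ∑ j, (x j * y i) * r j)
    (fun i ↦ memLp_sum_mul_pi_gaussianReal fun j ↦ x j * y i)
    fun i ↦ integral_sum_mul_pi_gaussianReal fun j ↦ x j * y i

lemma inner_eq_sum_mul (x x' : Euc m) : ⟪x, x'⟫_ℝ = ∑ j, x j * x' j := by
  simp [PiLp.inner_apply, mul_comm]

lemma integral_inner_mulE_mul_inner_mulE (x x' : Euc m) (y y' : Euc n) :
    ∫ G, ⟪y, mulE (Matrix.of G) x⟫_ℝ * ⟪y', mulE (Matrix.of G) x'⟫_ℝ ∂(stdGaussianPi n m) =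
      ⟪x, x'⟫_ℝ * ⟪y, y'⟫_ℝ := by
  simp only [inner_mulE, stdGaussianPi]
  rw [integral_sum_mul_sum_pi (a := fun i (r : Fin m → ℝ) ↦ ∑ j, (x j * y i) * r j)
    (a' := fun i (r : Fin m → ℝ) ↦ ∑ j, (x' j * y' i) * r j)
    (fun i ↦ memLp_sum_mul_pi_gaussianReal fun j ↦ x j * y i)
    (fun i ↦ memLp_sum_mul_pi_gaussianReal fun j ↦ x' j * y' i)
    fun i ↦ integral_sum_mul_pi_gaussianReal fun j ↦ x j * y i]
  simp only [integral_sum_mul_sum_pi_gaussianReal, inner_eq_sum_mul]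
  rw [Finset.sum_mul_sum, Finset.sum_comm]
  refine Finset.sum_congr rfl fun j _ ↦ Finset.sum_congr rfl fun i _ ↦ ?_
  ring

lemma memLp_inner_stdGaussianE (x : Euc m) : MemLp (fun g ↦ ⟪x, g⟫_ℝ) 2 (stdGaussianE m) := by
  rw [stdGaussianE, memLp_map_measure_iff (by fun_prop) (by fun_prop)]
  convert memLp_sum_mul_pi_gaussianReal fun j ↦ x j using 2
  simp [inner_eq_sum_mul]

lemma integral_inner_stdGaussianE (x : Euc m) : ∫ g, ⟪x, g⟫_ℝ ∂(stdGaussianE m) = 0 := by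
  rw [stdGaussianE, integral_map (by fun_prop) (by fun_prop)]
  convert integral_sum_mul_pi_gaussianReal fun j ↦ x j using 3
  simp [inner_eq_sum_mul]

lemma integral_inner_mul_inner_stdGaussianE (x x' : Euc m) :
    ∫ g, ⟪x, g⟫_ℝ * ⟪x', g⟫_ℝ ∂(stdGaussianE m) = ⟪x, x'⟫_ℝ := by
  rw [stdGaussianE, integral_map (by fun_prop) (by fun_prop), inner_eq_sum_mul x x',
    ← integral_sum_mul_sum_pi_gaussianReal (fun j ↦ x j) fun j ↦ x' j]
  simp [inner_eq_sum_mul]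

instance isGaussian_stdGaussianE (k : ℕ) : IsGaussian (stdGaussianE k) := by
  have := isGaussian_pi (ι := Fin k) (gaussianReal 0 1)
  exact isGaussian_map_equiv (EuclideanSpace.equiv (Fin k) ℝ).symm

instance isGaussian_stdGaussianPi (n m : ℕ) : IsGaussian (stdGaussianPi n m) := by
  have := isGaussian_pi (ι := Fin m) (gaussianReal 0 1)
  exact isGaussian_pi _

end GaussianMoments

section Chevet

variable {m n : ℕ}

/-- The functional `(G, t) ↦ ⟪y, G x⟫ + t`. -/
def matrixFunctional (x : Euc m) (y : Euc n) : StrongDual ℝ ((Fin n → Fin m → ℝ) × ℝ) :=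
  (∑ i, ∑ j, (x j * y i) • (ContinuousLinearMap.proj (R := ℝ) (φ := fun _ : Fin m ↦ ℝ) j ∘L
    ContinuousLinearMap.proj (R := ℝ) (φ := fun _ : Fin n ↦ Fin m → ℝ) i)) ∘L
      ContinuousLinearMap.fst ℝ (Fin n → Fin m → ℝ) ℝ +
    ContinuousLinearMap.snd ℝ (Fin n → Fin m → ℝ) ℝ

lemma matrixFunctional_apply (x : Euc m) (y : Euc n) (p : (Fin n → Fin m → ℝ) × ℝ) :
    matrixFunctional x y p = ⟪y, mulE (Matrix.of p.1) x⟫_ℝ + 1 * p.2 := by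
  simp [matrixFunctional, inner_mulE]

/-- The functional `(g', g) ↦ ⟪y, g'⟫ + ⟪x, g⟫`. -/
def pairFunctional (x : Euc m) (y : Euc n) : StrongDual ℝ (Euc n × Euc m) :=
  (innerSL ℝ y) ∘L ContinuousLinearMap.fst ℝ (Euc n) (Euc m) +
    (innerSL ℝ x) ∘L ContinuousLinearMap.snd ℝ (Euc n) (Euc m)

lemma pairFunctional_apply (x : Euc m) (y : Euc n) (p : Euc n × Euc m) :
    pairFunctional x y p = ⟪y, p.1⟫_ℝ + ⟪x, p.2⟫_ℝ := by
  simp [pairFunctional]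

lemma integral_matrixFunctional (x : Euc m) (y : Euc n) :
    ∫ p, matrixFunctional x y p ∂((stdGaussianPi n m).prod (gaussianReal 0 1)) = 0 := by
  simp only [matrixFunctional_apply]
  exact integral_add_prod_eq_zero (memLp_inner_mulE x y) (memLp_const_mul_gaussianReal 1)
    (integral_inner_mulE x y) (integral_const_mul_gaussianReal 1)

lemma integral_pairFunctional (x : Euc m) (y : Euc n) :
    ∫ p, pairFunctional x y p ∂((stdGaussianE n).prod (stdGaussianE m)) = 0 := by
  simp only [pairFunctional_apply]
  exact integral_add_prod_eq_zero (memLp_inner_stdGaussianE y) (memLp_inner_stdGaussianE x)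
    (integral_inner_stdGaussianE y) (integral_inner_stdGaussianE x)

lemma integral_matrixFunctional_mul (x x' : Euc m) (y y' : Euc n) :
    ∫ p, matrixFunctional x y p * matrixFunctional x' y' p
      ∂((stdGaussianPi n m).prod (gaussianReal 0 1)) = ⟪x, x'⟫_ℝ * ⟪y, y'⟫_ℝ + 1 := by
  simp only [matrixFunctional_apply]
  have h := integral_add_mul_add_prod (memLp_inner_mulE x y) (memLp_inner_mulE x' y')
    (memLp_const_mul_gaussianReal 1) (memLp_const_mul_gaussianReal 1)
    (integral_inner_mulE x y) (integral_inner_mulE x' y')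
  rwa [integral_inner_mulE_mul_inner_mulE, integral_const_mul_mul_gaussianReal, mul_one] at h

lemma integral_pairFunctional_mul (x x' : Euc m) (y y' : Euc n) :
    ∫ p, pairFunctional x y p * pairFunctional x' y' p
      ∂((stdGaussianE n).prod (stdGaussianE m)) = ⟪x, x'⟫_ℝ + ⟪y, y'⟫_ℝ := by
  simp only [pairFunctional_apply]
  have h := integral_add_mul_add_prod (memLp_inner_stdGaussianE y) (memLp_inner_stdGaussianE y')
    (memLp_inner_stdGaussianE x) (memLp_inner_stdGaussianE x')
    (integral_inner_stdGaussianE y) (integral_inner_stdGaussianE y')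
  rw [h, integral_inner_mul_inner_stdGaussianE, integral_inner_mul_inner_stdGaussianE, add_comm]

/-- The sum of the projection norms stochastically dominates the restricted norm of a Gaussian
matrix plus an independent Gaussian variable. -/
theorem measure_norm_metricProj_add_le {C : Set (Euc m)} {D : Set (Euc n)}
    (hC : IsClosedConvexCone C) (hCne : C ≠ {0}) (hD : IsClosedConvexCone D) (u : ℝ) :
    ((stdGaussianE n).prod (stdGaussianE m)) {p | ‖metricProj D p.1‖ + ‖metricProj C p.2‖ ≤ u} ≤
      ((stdGaussianPi n m).prod (gaussianReal 0 1))
        {p | resNorm C D (Matrix.of p.1) + p.2 ≤ u} := by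
  let T : Set (Euc m × Euc n) := (C ∩ sphere 0 1) ×ˢ (D ∩ closedBall 0 1)
  have : Nonempty T :=
    ((hC.inter_sphere_nonempty hCne).prod
      (show (D ∩ closedBall 0 1).Nonempty from ⟨0, hD.2.2.2, by simp⟩)).to_subtype
  let s : ℕ → T := TopologicalSpace.denseSeq T
  have hs : DenseRange s := TopologicalSpace.denseRange_denseSeq T
  have hnx (p : T) : ‖p.1.1‖ = 1 := by simpa using p.2.1.2
  have hny (p : T) : ‖p.1.2‖ ≤ 1 := by simpa using p.2.2.2
  have hslepian := slepian_dual ((stdGaussianPi n m).prod (gaussianReal 0 1))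
    ((stdGaussianE n).prod (stdGaussianE m))
    (fun i ↦ matrixFunctional (s i).1.1 (s i).1.2) (fun i ↦ pairFunctional (s i).1.1 (s i).1.2)
    (fun i ↦ integral_matrixFunctional _ _) (fun i ↦ integral_pairFunctional _ _)
    (fun i ↦ by
      rw [integral_matrixFunctional_mul, integral_pairFunctional_mul,
        real_inner_self_eq_norm_sq (s i).1.1, hnx]
      ring)
    (fun i j ↦ by
      rw [integral_matrixFunctional_mul, integral_pairFunctional_mul]
      have hx : ⟪(s i).1.1, (s j).1.1⟫_ℝ ≤ 1 :=
        (real_inner_le_norm _ _).trans_eq (by rw [hnx, hnx, one_mul])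
      have hy : ⟪(s i).1.2, (s j).1.2⟫_ℝ ≤ 1 :=
        (real_inner_le_norm _ _).trans (mul_le_one₀ (hny _) (norm_nonneg _) (hny _))
      nlinarith [mul_nonneg (sub_nonneg.2 hx) (sub_nonneg.2 hy)]) u
  refine (measure_mono fun p hp i ↦ ?_).trans (hslepian.trans (measure_mono fun p hp ↦ ?_))
  · have h1 := (hD.norm_metricProj_le_iff p.1 _).1 le_rfl _ (s i).2.2
    have h2 := (hC.norm_metricProj_le_iff p.2 _).1 le_rfl _
      ⟨(s i).2.1.1, sphere_subset_closedBall (s i).2.1.2⟩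
    rw [pairFunctional_apply]
    exact (add_le_add h1 h2).trans hp
  · have hall : ∀ q : T, matrixFunctional q.1.1 q.1.2 p ≤ u := by
      have hcl : IsClosed {q : T | matrixFunctional q.1.1 q.1.2 p ≤ u} := by
        simp only [matrixFunctional_apply, inner_mulE]
        exact isClosed_le (by fun_prop) continuous_const
      exact fun q ↦ hs.induction_on q hcl hp
    rw [mem_ofPred_eq, ← le_sub_iff_add_le, resNorm_le_iff hC hCne hD]
    intro x hx z hz
    have := hall ⟨(x, z), hx, hz⟩
    rw [matrixFunctional_apply] at this
    simp only [one_mul] at this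
    linarith

end Chevet

/-- For closed convex cones `C ≠ {0}`, `D`, a standard Gaussian matrix `G`,
independent standard Gaussian vectors `g, g'`, and a monotone convex `f` with both sides
integrable, `E[f(‖G‖_{C→D})] ≤ E[f(‖Proj_D g'‖ + ‖Proj_C g‖)]`. -/
theorem statement0 {m n : ℕ} (C : Set (Euc m)) (D : Set (Euc n))
    (hC : IsClosedConvexCone C) (hCne : C ≠ {0}) (hD : IsClosedConvexCone D)
    (f : ℝ → ℝ) (hf_mono : Monotone f) (hf_conv : ConvexOn ℝ Set.univ f)
    (hint1 : Integrable (fun G : Fin n → Fin m → ℝ => f (resNorm C D (Matrix.of G)))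
      (stdGaussianPi n m))
    (hint2 : Integrable
      (fun p : Euc n × Euc m => f (‖metricProj D p.1‖ + ‖metricProj C p.2‖))
      ((stdGaussianE n).prod (stdGaussianE m))) :
    ∫ G, f (resNorm C D (Matrix.of G)) ∂(stdGaussianPi n m)
      ≤ ∫ p, f (‖metricProj D p.1‖ + ‖metricProj C p.2‖)
          ∂((stdGaussianE n).prod (stdGaussianE m)) := by
  exact integral_le_of_gaussian_domination (measurable_resNorm hC hCne hD)
    ((hD.measurable_norm_metricProj.comp measurable_fst).add
      (hC.measurable_norm_metricProj.comp measurable_snd))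
    (measure_norm_metricProj_add_le hC hCne hD) hf_mono hf_conv hint1 hint2

end
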